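/- For every N ≥ 1, every r ≥ 1 and every f ∈ Λ̄, one has φ_N(L^{(r)}(f)) = Σ_{i=1}^N D_{i,N}^r(φ_N(f)); that is, under the specialization φ_N the rational CMS integral at infinity L^{(r)} reduces to the Heckman operator Res(D_{1,N}^r + ⋯ + D_{N,N}^r) on symmetric polynomials. -/

import Mathlib

open Polynomial MvPolynomial

noncomputable section

/-- Λ̄ = ℂ[p₀,p₁,…] -/
abbrev Lam : Type := MvPolynomial ℕ ℂ
/-- Λ̄[x] -/
abbrev LamX : Type := Polynomial Lam

/-- the derivation on coefficients: p_l ↦ l·x^{l-1} -/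
def coeffDer : Derivation ℂ Lam LamX :=
  MvPolynomial.mkDerivation ℂ (fun l => (l : LamX) * Polynomial.X ^ (l - 1))

/-- ∂ : the ℂ-derivation of Λ̄[x] with ∂x = 1, ∂p_l = l x^{l-1}. -/
def pd (f : LamX) : LamX :=
  Polynomial.derivative f + f.sum (fun i c => coeffDer c * Polynomial.X ^ i)

/-- Δ(x^l). -/
def Dvals (l : ℕ) : LamX :=
  if l = 0 then 0 else
    (∑ j ∈ Finset.range l, Polynomial.X ^ (l - 1 - j) * Polynomial.C (MvPolynomial.X j))
      - (l : LamX) * Polynomial.X ^ (l - 1)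

/-- Δ : Λ̄-linear, Δ(x^l f) = Δ(x^l)·f. -/
def Del (f : LamX) : LamX := f.sum (fun l c => Polynomial.C c * Dvals l)

/-- Dunkl operator at infinity, D_k = ∂ − kΔ. -/
def Dk (k : ℂ) (f : LamX) : LamX := pd f - k • Del f

/-- E : Λ̄[x] → Λ̄, x^l f ↦ p_l f. -/
def E (f : LamX) : Lam := f.sum (fun l c => c * MvPolynomial.X l)

/-- L^{(r)} = E ∘ D_k^r restricted to Λ̄. -/
def Lr (k : ℂ) (r : ℕ) (f : Lam) : Lam := E ((Dk k)^[r] (Polynomial.C f))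

end

noncomputable section

/-- φ_N : Λ̄ → ℂ[x₁,…,x_N], p_l ↦ x₁^l + ⋯ + x_N^l. -/
def phiN (N : ℕ) : Lam →+* MvPolynomial (Fin N) ℂ :=
  (MvPolynomial.aeval (fun l : ℕ => ∑ j : Fin N, MvPolynomial.X j ^ l) :
    Lam →ₐ[ℂ] MvPolynomial (Fin N) ℂ).toRingHom

/-- the field of rational functions ℂ(x₁,…,x_N) -/
abbrev FN (N : ℕ) : Type := FractionRing (MvPolynomial (Fin N) ℂ)

/-- the embedding ℂ[x₁,…,x_N] → ℂ(x₁,…,x_N) -/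
def embN (N : ℕ) (f : MvPolynomial (Fin N) ℂ) : FN N := algebraMap _ _ f

/-- numerator of a chosen fraction representation of z -/
def numN (N : ℕ) (z : FN N) : MvPolynomial (Fin N) ℂ :=
  (IsLocalization.sec (nonZeroDivisors (MvPolynomial (Fin N) ℂ)) z).1

/-- denominator of a chosen fraction representation of z -/
def denN (N : ℕ) (z : FN N) : MvPolynomial (Fin N) ℂ :=
  ((IsLocalization.sec (nonZeroDivisors (MvPolynomial (Fin N) ℂ)) z).2 :
    MvPolynomial (Fin N) ℂ)

/-- ∂/∂x_i on ℂ(x₁,…,x_N), extending `MvPolynomial.pderiv i` by the quotient rule. -/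
def fderN (N : ℕ) (i : Fin N) (z : FN N) : FN N :=
  (embN N (MvPolynomial.pderiv i (numN N z)) * embN N (denN N z)
    - embN N (numN N z) * embN N (MvPolynomial.pderiv i (denN N z)))
  / (embN N (denN N z)) ^ 2

/-- the involution σ_{ij} (permuting x_i and x_j) extended to ℂ(x₁,…,x_N). -/
def swapN (N : ℕ) (i j : Fin N) (z : FN N) : FN N :=
  embN N (MvPolynomial.rename (Equiv.swap i j) (numN N z))
    / embN N (MvPolynomial.rename (Equiv.swap i j) (denN N z))

/-- the Dunkl operator D_{i,N} = ∂/∂x_i − k Σ_{j≠i} (x_i−x_j)^{-1}(1−σ_{ij}),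
as an operator on ℂ(x₁,…,x_N) (it preserves the polynomial subring). -/
def DunklN (k : ℂ) (N : ℕ) (i : Fin N) (z : FN N) : FN N :=
  fderN N i z - k • ∑ j ∈ Finset.univ.erase i,
    (z - swapN N i j z) / (embN N (MvPolynomial.X i) - embN N (MvPolynomial.X j))

end

noncomputable section

/-- The specialization Λ̄[x] → ℂ[x₁,…,x_N] extending φ_N by x ↦ x_i. -/
def specAt (N : ℕ) (i : Fin N) : LamX →+* MvPolynomial (Fin N) ℂ :=
  Polynomial.eval₂RingHom (phiN N) (MvPolynomial.X i)

end

theorem specAt_C (N : ℕ) (i : Fin N) (c : Lam) : specAt N i (Polynomial.C c) = phiN N c := by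
  simp [specAt]

theorem specAt_X (N : ℕ) (i : Fin N) : specAt N i Polynomial.X = MvPolynomial.X i := by
  simp [specAt]

theorem specAt_smul (N : ℕ) (i : Fin N) (k : ℂ) (g : LamX) :
    specAt N i (k • g) = k • specAt N i g := by
  have h : k • g = Polynomial.C (MvPolynomial.C k) * g := by
    rw [← Polynomial.smul_eq_C_mul, ← MvPolynomial.algebraMap_eq, algebraMap_smul]
  rw [h, map_mul, specAt_C, MvPolynomial.smul_eq_C_mul]
  simp [phiN]

theorem phiN_X (N l : ℕ) :
    phiN N (MvPolynomial.X l) = ∑ j : Fin N, (MvPolynomial.X j : MvPolynomial (Fin N) ℂ) ^ l := by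
  simp [phiN]

theorem rename_phiN (N : ℕ) (e : Equiv.Perm (Fin N)) (c : Lam) :
    MvPolynomial.rename e (phiN N c) = phiN N c := by
  induction c using MvPolynomial.induction_on with
  | C a => simp [phiN]
  | add p q hp hq => simp [hp, hq]
  | mul_X p l hp =>
    rw [map_mul, map_mul, hp, phiN_X, map_sum]
    congr 1
    simp only [map_pow, MvPolynomial.rename_X]
    exact Equiv.sum_comp e (fun j => (MvPolynomial.X j : MvPolynomial (Fin N) ℂ) ^ l)

theorem pderiv_phiN (N : ℕ) (i : Fin N) (c : Lam) :
    MvPolynomial.pderiv i (phiN N c) = specAt N i (coeffDer c) := by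
  induction c using MvPolynomial.induction_on with
  | C a =>
    have h : coeffDer (MvPolynomial.C a) = 0 := coeffDer.map_algebraMap a
    rw [h]
    simp [phiN]
  | add p q hp hq => simp [hp, hq]
  | mul_X p l hp =>
    have h : coeffDer (MvPolynomial.X l) = (l : LamX) * Polynomial.X ^ (l - 1) :=
      MvPolynomial.mkDerivation_X _ _ _
    have hX : MvPolynomial.pderiv i (phiN N (MvPolynomial.X l)) =
        specAt N i (coeffDer (MvPolynomial.X l)) := by
      rw [h, phiN_X, map_sum, Finset.sum_eq_single i]
      · simp [specAt_X, Derivation.leibniz_pow]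
      · intro j _ hj
        simp [Derivation.leibniz_pow, MvPolynomial.pderiv_X_of_ne hj]
      · simp
    rw [map_mul, Derivation.leibniz, Derivation.leibniz, hp, hX, map_add]
    simp only [smul_eq_mul, Polynomial.smul_eq_C_mul, map_mul, specAt_C]

theorem pd_add (f g : LamX) : pd (f + g) = pd f + pd g := by
  unfold pd
  rw [Polynomial.sum_add_index f g _ (by simp) (by intros; simp [add_mul]), map_add]
  ring

theorem Del_add (f g : LamX) : Del (f + g) = Del f + Del g := by
  unfold Del
  rw [Polynomial.sum_add_index f g _ (by simp) (by intros; simp [add_mul])]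

theorem E_add (f g : LamX) : E (f + g) = E f + E g := by
  unfold E
  rw [Polynomial.sum_add_index f g _ (by simp) (by intros; simp [add_mul])]

theorem pderiv_specAt (N : ℕ) (i : Fin N) (g : LamX) :
    MvPolynomial.pderiv i (specAt N i g) = specAt N i (pd g) := by
  induction g using Polynomial.induction_on' with
  | add p q hp hq => rw [map_add, map_add, hp, hq, pd_add, map_add]
  | monomial l c =>
    unfold pd
    rw [Polynomial.sum_monomial_index _ _ (by simp), ← Polynomial.C_mul_X_pow_eq_monomial]
    simp only [map_mul, map_pow, map_add, specAt_C, specAt_X, Derivation.leibniz,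
      Derivation.leibniz_pow, pderiv_phiN, Polynomial.derivative_C_mul_X_pow,
      MvPolynomial.pderiv_X_self, smul_eq_mul, map_natCast, nsmul_eq_mul]
    ring

theorem specAt_Dvals (N : ℕ) (i : Fin N) (l : ℕ) :
    specAt N i (Dvals l) = ∑ j ∈ Finset.univ.erase i, ∑ m ∈ Finset.range l,
      (MvPolynomial.X i : MvPolynomial (Fin N) ℂ) ^ (l - 1 - m) * MvPolynomial.X j ^ m := by
  rcases Nat.eq_zero_or_pos l with rfl | hl
  · simp [Dvals]
  rw [Dvals, if_neg hl.ne', Finset.sum_erase_eq_sub (Finset.mem_univ i), map_sub, map_sum,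
    Finset.sum_comm]
  congr 1
  · simp only [map_mul, map_pow, specAt_X, specAt_C, phiN_X, Finset.mul_sum]
  · simp only [map_mul, map_pow, specAt_X, map_natCast]
    rw [Finset.sum_congr rfl (g := fun _ => MvPolynomial.X i ^ (l - 1))]
    · simp
    · intro m hm
      rw [← pow_add]
      congr 1
      have := Finset.mem_range.1 hm
      omega

theorem embN_add (N : ℕ) (p q : MvPolynomial (Fin N) ℂ) :
    embN N (p + q) = embN N p + embN N q := map_add _ _ _

theorem embN_sub (N : ℕ) (p q : MvPolynomial (Fin N) ℂ) :
    embN N (p - q) = embN N p - embN N q := map_sub _ _ _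

theorem embN_mul (N : ℕ) (p q : MvPolynomial (Fin N) ℂ) :
    embN N (p * q) = embN N p * embN N q := map_mul _ _ _

theorem embN_smul (N : ℕ) (k : ℂ) (p : MvPolynomial (Fin N) ℂ) :
    embN N (k • p) = k • embN N p :=
  map_smul (IsScalarTower.toAlgHom ℂ (MvPolynomial (Fin N) ℂ) (FN N)) k p

theorem embN_sum (N : ℕ) {ι : Type*} (s : Finset ι) (p : ι → MvPolynomial (Fin N) ℂ) :
    embN N (∑ j ∈ s, p j) = ∑ j ∈ s, embN N (p j) := map_sum _ _ _

theorem embN_injective (N : ℕ) : Function.Injective (embN N) :=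
  IsFractionRing.injective (MvPolynomial (Fin N) ℂ) (FN N)

theorem embN_ne_zero (N : ℕ) {p : MvPolynomial (Fin N) ℂ} (hp : p ≠ 0) : embN N p ≠ 0 :=
  (map_ne_zero_iff _ (IsFractionRing.injective (MvPolynomial (Fin N) ℂ) (FN N))).2 hp

theorem denN_ne_zero (N : ℕ) (z : FN N) : denN N z ≠ 0 :=
  nonZeroDivisors.ne_zero (IsLocalization.sec _ z).2.2

theorem numN_embN (N : ℕ) (p : MvPolynomial (Fin N) ℂ) :
    numN N (embN N p) = p * denN N (embN N p) := by
  apply embN_injective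
  rw [embN_mul]
  exact (IsLocalization.sec_spec (nonZeroDivisors (MvPolynomial (Fin N) ℂ)) (embN N p)).symm

theorem fderN_embN (N : ℕ) (i : Fin N) (p : MvPolynomial (Fin N) ℂ) :
    fderN N i (embN N p) = embN N (MvPolynomial.pderiv i p) := by
  have hd := embN_ne_zero N (denN_ne_zero N (embN N p))
  rw [fderN, numN_embN, div_eq_iff (pow_ne_zero 2 hd), Derivation.leibniz]
  simp only [smul_eq_mul, embN_add, embN_mul]
  ring

theorem swapN_embN (N : ℕ) (i j : Fin N) (p : MvPolynomial (Fin N) ℂ) :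
    swapN N i j (embN N p) = embN N (MvPolynomial.rename (Equiv.swap i j) p) := by
  have hd : MvPolynomial.rename (Equiv.swap i j) (denN N (embN N p)) ≠ 0 :=
    (map_ne_zero_iff _ (MvPolynomial.rename_injective _ (Equiv.swap i j).injective)).2
      (denN_ne_zero N _)
  rw [swapN, numN_embN, map_mul, embN_mul, mul_div_cancel_right₀ _ (embN_ne_zero N hd)]

theorem sum_divided_difference_specAt (N : ℕ) (i : Fin N) (g : LamX) :
    ∑ j ∈ Finset.univ.erase i,
      (embN N (specAt N i g) - swapN N i j (embN N (specAt N i g))) /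
        (embN N (MvPolynomial.X i) - embN N (MvPolynomial.X j)) =
      embN N (specAt N i (Del g)) := by
  induction g using Polynomial.induction_on' with
  | add p q hp hq =>
    rw [Del_add, map_add, map_add, embN_add N (specAt N i (Del p)), ← hp, ← hq,
      ← Finset.sum_add_distrib]
    refine Finset.sum_congr rfl fun j _ => ?_
    rw [swapN_embN, swapN_embN, swapN_embN, map_add, embN_add, embN_add]
    ring
  | monomial l c =>
    unfold Del
    rw [Polynomial.sum_monomial_index _ _ (by simp), ← Polynomial.C_mul_X_pow_eq_monomial, map_mul,
      map_mul, map_pow, specAt_C, specAt_X, specAt_Dvals, Finset.mul_sum, embN_sum]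
    refine Finset.sum_congr rfl fun j hj => ?_
    have hij : (MvPolynomial.X i : MvPolynomial (Fin N) ℂ) - MvPolynomial.X j ≠ 0 :=
      sub_ne_zero.2 fun h => (Finset.ne_of_mem_erase hj) (MvPolynomial.X_injective h).symm
    rw [swapN_embN, ← embN_sub, ← embN_sub, div_eq_iff (embN_ne_zero N hij), ← embN_mul, map_mul,
      rename_phiN, map_pow, MvPolynomial.rename_X, Equiv.swap_apply_left, ← mul_sub, mul_assoc]
    have hg := geom_sum₂_mul (MvPolynomial.X j : MvPolynomial (Fin N) ℂ) (MvPolynomial.X i) l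
    rw [← neg_sub (MvPolynomial.X j ^ l), ← hg, ← neg_sub (MvPolynomial.X j)]
    simp only [mul_neg, mul_comm (MvPolynomial.X j ^ _ : MvPolynomial (Fin N) ℂ)]

theorem DunklN_specAt (k : ℂ) (N : ℕ) (i : Fin N) (g : LamX) :
    DunklN k N i (embN N (specAt N i g)) = embN N (specAt N i (Dk k g)) := by
  rw [DunklN, Dk, sum_divided_difference_specAt, fderN_embN, pderiv_specAt, map_sub, specAt_smul,
    embN_sub, embN_smul]

theorem phiN_E (N : ℕ) (g : LamX) : phiN N (E g) = ∑ i : Fin N, specAt N i g := by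
  induction g using Polynomial.induction_on' with
  | add p q hp hq => simp only [E_add, map_add, hp, hq, Finset.sum_add_distrib]
  | monomial l c =>
    unfold E
    rw [Polynomial.sum_monomial_index _ _ (by simp), ← Polynomial.C_mul_X_pow_eq_monomial]
    simp only [map_mul, map_pow, specAt_C, specAt_X, phiN_X, Finset.mul_sum]

/-- for all N ≥ 1, r ≥ 1 and f ∈ Λ̄,
φ_N(L^{(r)}(f)) = Σ_{i=1}^N D_{i,N}^r(φ_N(f)): under φ_N the rational CMS integral at
infinity reduces to the Heckman operator Res(D_{1,N}^r + ⋯ + D_{N,N}^r).  (The identity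
is stated in the field of rational functions, into which ℂ[x₁,…,x_N] embeds.) -/
theorem Lr_specializes_to_Heckman (k : ℂ) (N : ℕ) (hN : 1 ≤ N)
    (r : ℕ) (hr : 1 ≤ r) (f : Lam) :
    embN N (phiN N (Lr k r f)) =
      ∑ i : Fin N, (DunklN k N i)^[r] (embN N (phiN N f)) := by
  have h (i : Fin N) : (DunklN k N i)^[r] (embN N (phiN N f)) =
      embN N (specAt N i ((Dk k)^[r] (Polynomial.C f))) := by
    rw [← specAt_C N i]
    have hs : Function.Semiconj (fun g => embN N (specAt N i g)) (Dk k) (DunklN k N i) :=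
      fun g => (DunklN_specAt k N i g).symm
    exact ((hs.iterate_right r) (Polynomial.C f)).symm
  rw [Lr, phiN_E, embN_sum]
  exact Finset.sum_congr rfl fun i _ => (h i).symm
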